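/- There do not exist a real number a ≥ 0, real numbers y₁, y₂ > 0, and a skew-symmetric bilinear form Q on ℝ⁴ such that N₁ and a·N₁ + N₂ are infinitesimal isometries of Q and such that for every nonzero u in the ℂ-span of e₁(y) and e₂(y) the number i·Q_ℂ(u, ū) is a positive real number (ū denoting coordinatewise complex conjugation on ℂ⁴). In other words, the Deligne–Hodge system with monodromy operators N₁, a·N₁ + N₂ and Hodge filtration spanned by e₁, e₂ admits no polarizing form, so it is not an infinitesimal mixed Hodge module; this contradicts Kato's Theorem 1.4. -/

import Mathlib

open Matrix

/-- The matrix of `N₁` on `ℝ⁴` in the ordered basis `(e₁, f₁, e₂, f₂)`: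
`N₁e₁ = f₁`, `N₁e₂ = f₂`, `N₁f₁ = N₁f₂ = 0`. -/
def n1 : Matrix (Fin 4) (Fin 4) ℝ := !![0,0,0,0; 1,0,0,0; 0,0,0,0; 0,0,1,0]

/-- The matrix of `N₂`: `N₂e₁ = f₂`, `N₂f₁ = N₂e₂ = N₂f₂ = 0`. -/
def n2 : Matrix (Fin 4) (Fin 4) ℝ := !![0,0,0,0; 0,0,0,0; 0,0,0,0; 1,0,0,0]

/-- The real bilinear form attached to the matrix `q`. -/
def Qr (q : Matrix (Fin 4) (Fin 4) ℝ) (u v : Fin 4 → ℝ) : ℝ := u ⬝ᵥ q.mulVec v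

/-- The complexification `Q_ℂ` of the bilinear form attached to `q`. -/
noncomputable def Qc (q : Matrix (Fin 4) (Fin 4) ℝ) (u v : Fin 4 → ℂ) : ℂ :=
  u ⬝ᵥ (q.map (Complex.ofReal)).mulVec v

/-- `e₁(y) = e₁ + i(y₁ + a y₂) f₁ + i y₂ f₂` in coordinates `(e₁, f₁, e₂, f₂)`. -/
def e1y (a y₁ y₂ : ℝ) : Fin 4 → ℂ :=
  ![1, (↑y₁ + ↑a * ↑y₂) * Complex.I, 0, ↑y₂ * Complex.I]

/-- `e₂(y) = e₂ + i(y₁ + a y₂) f₂`. -/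
def e2y (a y₁ y₂ : ℝ) : Fin 4 → ℂ :=
  ![0, 0, 1, (↑y₁ + ↑a * ↑y₂) * Complex.I]

theorem Qr_single (q : Matrix (Fin 4) (Fin 4) ℝ) (i j : Fin 4) :
    Qr q (Pi.single i 1) (Pi.single j 1) = q i j := by
  simp [Qr]

/-- If the form vanishes on the span of the basis vectors `e₂, f₂`, then
`Q_ℂ(e₂(y), conj e₂(y)) = 0`. -/
theorem Qc_e2y_star {q : Matrix (Fin 4) (Fin 4) ℝ} {a y₁ y₂ : ℝ} (h₂₂ : q 2 2 = 0)
    (h₃₃ : q 3 3 = 0) (h₂₃ : q 2 3 = 0) (h₃₂ : q 3 2 = 0) :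
    Qc q (e2y a y₁ y₂) (star (e2y a y₁ y₂)) = 0 := by
  simp [Qc, e2y, Matrix.mulVec, dotProduct, Fin.sum_univ_four, h₂₂, h₃₃, h₂₃, h₃₂]

/-- counterexample to Kato's Theorem 1.4: there do not exist `a ≥ 0`,
`y₁, y₂ > 0` and a skew-symmetric bilinear form `Q` on `ℝ⁴` such that `N₁` and `a·N₁ + N₂`
are infinitesimal isometries of `Q` and `i·Q_ℂ(u, ū)` is a positive real number for every
nonzero `u` in the `ℂ`-span of `e₁(y)` and `e₂(y)`. -/
theorem stmt17 :
    ¬ ∃ (a y₁ y₂ : ℝ) (q : Matrix (Fin 4) (Fin 4) ℝ),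
      0 ≤ a ∧ 0 < y₁ ∧ 0 < y₂ ∧
      (∀ u v : Fin 4 → ℝ, Qr q u v = - Qr q v u) ∧
      (∀ u v : Fin 4 → ℝ, Qr q (n1.mulVec u) v + Qr q u (n1.mulVec v) = 0) ∧
      (∀ u v : Fin 4 → ℝ,
        Qr q ((a • n1 + n2).mulVec u) v + Qr q u ((a • n1 + n2).mulVec v) = 0) ∧
      (∀ u : Fin 4 → ℂ, u ∈ Submodule.span ℂ {e1y a y₁ y₂, e2y a y₁ y₂} → u ≠ 0 →
        0 < (Complex.I * Qc q u (star u)).re ∧ (Complex.I * Qc q u (star u)).im = 0) := by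
  rintro ⟨a, y₁, y₂, q, -, -, -, hskew, hN₁, hN, hpos⟩
  have h₂₂ := hskew (Pi.single 2 1) (Pi.single 2 1)
  have h₃₃ := hskew (Pi.single 3 1) (Pi.single 3 1)
  have h₂₃ := hskew (Pi.single 2 1) (Pi.single 3 1)
  have hN₁' := hN₁ (Pi.single 0 1) (Pi.single 2 1)
  have hN' := hN (Pi.single 0 1) (Pi.single 2 1)
  simp only [Qr_single] at h₂₂ h₃₃ h₂₃
  simp [Qr, n1, n2, Matrix.mulVec, dotProduct, Fin.sum_univ_four] at hN₁' hN'
  have h₃₂ : q 3 2 = 0 := by linear_combination hN' - a * hN₁'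
  have hne : e2y a y₁ y₂ ≠ 0 := fun h => by simpa [e2y] using congrFun h 2
  obtain ⟨hre, -⟩ := hpos _ (Submodule.subset_span (by simp)) hne
  rw [Qc_e2y_star (by linarith) (by linarith) (by linarith) h₃₂] at hre
  simp at hre
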